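/- Let σ > 0, a < b, μ₀ and t be real numbers, and define L(y) = ((b − a)/σ²)·(y − (a + b)/2) and g(μ₀, t) = μ₀/(√2·σ) − (1/(2√2·σ))·(a + b + 2σ²t/(b − a)). Then (gaussianReal μ₀ σ²){ y : L(y) ≤ t } = (1/√π) ∫_{g(μ₀,t)}^{∞} e^{−x²} dx. -/

import Mathlib

open MeasureTheory ProbabilityTheory Set Real
open scoped NNReal

/-- The standardization `x ↦ (μ - x) / (√2 σ)` sends `N(μ, σ²)` to `N(0, 1/2)`. -/
lemma gaussianReal_map_const_sub_div_sqrt_two_mul (μ : ℝ) {σ : ℝ≥0} (hσ : σ ≠ 0) :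
    (gaussianReal μ (σ ^ 2)).map (fun x => (μ - x) / (Real.sqrt 2 * σ)) =
      gaussianReal 0 (1 / 2) := by
  have hσ' : (σ : ℝ) ≠ 0 := by exact_mod_cast hσ
  have h : (fun x : ℝ => (μ - x) / (Real.sqrt 2 * σ)) =
      (fun x => x / (Real.sqrt 2 * σ)) ∘ (fun x => μ - x) := rfl
  rw [h, ← Measure.map_map (by fun_prop) (by fun_prop), gaussianReal_map_const_sub,
    gaussianReal_map_div_const, sub_self, zero_div]
  congr 1
  ext
  simp [mul_pow]
  field_simp

/-- Upper tail of `N(0, 1/2)` as an integral of `exp (-x ^ 2)`. -/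
lemma gaussianReal_zero_half_real_Ici (g : ℝ) :
    (gaussianReal 0 (1 / 2)).real (Ici g) =
      (1 / Real.sqrt π) * ∫ x in Ioi g, Real.exp (-x ^ 2) := by
  rw [measureReal_def, gaussianReal_apply_eq_integral 0 (by norm_num), ENNReal.toReal_ofReal
    (integral_nonneg fun x => gaussianPDFReal_nonneg _ _ x), integral_Ici_eq_integral_Ioi,
    ← integral_const_mul]
  congr 1 with x
  simp [gaussianPDFReal]
  field_simp

/-- Lower tail of `N(μ, σ²)` as an integral of `exp (-x ^ 2)`. -/
lemma gaussianReal_real_Iic (μ c : ℝ) {σ : ℝ≥0} (hσ : σ ≠ 0) :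
    (gaussianReal μ (σ ^ 2)).real (Iic c) =
      (1 / Real.sqrt π) * ∫ x in Ioi ((μ - c) / (Real.sqrt 2 * σ)), Real.exp (-x ^ 2) := by
  have hs : 0 < Real.sqrt 2 * (σ : ℝ) := by positivity
  rw [← gaussianReal_zero_half_real_Ici, ← gaussianReal_map_const_sub_div_sqrt_two_mul μ hσ,
    map_measureReal_apply (by fun_prop) measurableSet_Ici]
  congr 1
  ext x
  rw [mem_Iic, mem_preimage, mem_Ici, div_le_div_iff_of_pos_right hs, sub_le_sub_iff_left]

/-- Equation (4) of Example 1: the distribution function of the log-likelihood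
ratio `L` under `N(μ₀, σ²)` equals the Gaussian tail integral
`(1/√π) ∫_{g(μ₀,t)}^{∞} e^{−x²} dx`. -/
theorem gaussian_loglikelihood_cdf_eq_tail_integral
    (σ : ℝ≥0) (hσ : 0 < σ) (a b μ₀ t : ℝ) (hab : a < b)
    (L : ℝ → ℝ) (hL : L = fun y => ((b - a) / (σ : ℝ) ^ 2) * (y - (a + b) / 2))
    (g : ℝ) (hg : g = μ₀ / (Real.sqrt 2 * (σ : ℝ)) -
      (1 / (2 * Real.sqrt 2 * (σ : ℝ))) * (a + b + 2 * (σ : ℝ) ^ 2 * t / (b - a))) :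
    ((gaussianReal μ₀ (σ ^ 2)) {y : ℝ | L y ≤ t}).toReal =
      (1 / Real.sqrt π) * ∫ x in Ioi g, Real.exp (-x ^ 2) := by
  have hσ' : (0 : ℝ) < σ := by exact_mod_cast hσ
  have hba : 0 < b - a := sub_pos.mpr hab
  have hset : {y : ℝ | L y ≤ t} = Iic ((a + b) / 2 + σ ^ 2 * t / (b - a)) := by
    ext y
    simp only [mem_ofPred_eq, mem_Iic, hL]
    rw [← sub_le_iff_le_add', le_div_iff₀ hba, div_mul_eq_mul_div, div_le_iff₀ (by positivity),
      mul_comm (b - a), mul_comm t]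
  have hg' : g = (μ₀ - ((a + b) / 2 + σ ^ 2 * t / (b - a))) / (Real.sqrt 2 * σ) := by
    rw [hg]
    field_simp
  rw [hset, hg', ← measureReal_def, gaussianReal_real_Iic _ _ hσ.ne']
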